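/- Let ξ and ξ' be two primitive p-th roots of unity in L. Then for each m = 1, …, r, the symmetric sums agree: ∑_{1 ≤ i_1 < ⋯ < i_m ≤ r} ∏_{j=1}^m (ξ^{i_j} + ξ^{-i_j}) = ∑_{1 ≤ i_1 < ⋯ < i_m ≤ r} ∏_{j=1}^m (ξ'^{i_j} + ξ'^{-i_j}). In other words, the quantity U^{(m)} = ∑_{1 ≤ i_1 < ⋯ < i_m ≤ r} ∏_{j=1}^m (ξ^{i_j} + ξ^{-i_j}) does not depend on the choice of primitive p-th root of unity ξ. -/

import Mathlib

theorem aux_eq {L : Type} [Field L] (p : ℕ) [Fact p.Prime] (ξ : L) (h : ξ ^ p = 1) (k i : ℕ) :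
    (ξ ^ k) ^ i + (ξ ^ k)⁻¹ ^ i =
      ξ ^ ((k : ZMod p) * (i : ZMod p)).valMinAbs.natAbs
        + ξ⁻¹ ^ ((k : ZMod p) * (i : ZMod p)).valMinAbs.natAbs := by
  have h0 : ξ ≠ 0 := by
    rintro rfl
    simp [(Fact.out : p.Prime).ne_zero] at h
  set z := ((k : ZMod p) * (i : ZMod p)).valMinAbs with hz
  have h1 : ((z : ℤ) : ZMod p) = (((k * i : ℕ) : ℤ) : ZMod p) := by
    rw [hz, ZMod.coe_valMinAbs]; push_cast; rfl
  rw [ZMod.intCast_eq_intCast_iff_dvd_sub] at h1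
  obtain ⟨c, hc⟩ := h1
  have h2 : ξ ^ z = (ξ ^ k) ^ i := by
    have : ((k * i : ℕ) : ℤ) = z + p * c := by omega
    rw [← pow_mul, ← zpow_natCast ξ (k * i), this, zpow_add₀ h0, zpow_mul, zpow_natCast, h]
    simp
  rw [inv_pow, inv_pow, ← h2]
  rcases Int.natAbs_eq z with h3 | h3
  · conv_lhs => rw [h3]
    simp only [zpow_natCast]
  · conv_lhs => rw [h3]
    simp only [zpow_neg, zpow_natCast, inv_inv]
    rw [add_comm]

/-- The quantity `U^(m) = ∑_{1 ≤ i₁ < ⋯ < i_m ≤ r} ∏_j (ξ^{i_j} + ξ^{-i_j})` does not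
depend on the choice of the primitive `p`-th root of unity `ξ` in the `p`-th
cyclotomic field `L`. -/
theorem stmt_5 (p : ℕ+) (hp : (p : ℕ).Prime) (hodd : Odd (p : ℕ))
    (L : Type) [Field L] [Algebra ℚ L] [IsCyclotomicExtension {(p : ℕ)} ℚ L]
    (r : ℕ) (hr : r = ((p : ℕ) - 1) / 2)
    (ξ ξ' : L) (hξ : ξ ^ (p : ℕ) = 1) (hξ1 : ξ ≠ 1)
    (hξ' : ξ' ^ (p : ℕ) = 1) (hξ'1 : ξ' ≠ 1)
    (m : ℕ) (hm1 : 1 ≤ m) (hmr : m ≤ r) :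
    ∑ s ∈ Finset.powersetCard m (Finset.Icc 1 r), ∏ i ∈ s, (ξ ^ i + ξ⁻¹ ^ i)
      = ∑ s ∈ Finset.powersetCard m (Finset.Icc 1 r), ∏ i ∈ s, (ξ' ^ i + ξ'⁻¹ ^ i) := by
  haveI : Fact (p : ℕ).Prime := ⟨hp⟩
  have hprim : IsPrimitiveRoot ξ (p : ℕ) := by
    rw [← orderOf_eq_prime hξ hξ1]; exact IsPrimitiveRoot.orderOf ξ
  obtain ⟨k, hk, rfl⟩ := hprim.eq_pow_of_pow_eq_one hξ'
  have hk0 : ((k : ℕ) : ZMod p) ≠ 0 := by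
    intro h
    rw [ZMod.natCast_eq_zero_iff] at h
    obtain ⟨c, rfl⟩ := h
    apply hξ'1
    rw [pow_mul, hξ, one_pow]
  have hI : Finset.Icc 1 r = Finset.Ico 1 ((p : ℕ) / 2).succ := by
    obtain ⟨a, ha⟩ := hodd
    ext x
    simp only [Finset.mem_Icc, Finset.mem_Ico]
    omega
  have key := ZMod.Ico_map_valMinAbs_natAbs_eq_Ico_map_id (p : ℕ) (k : ZMod p) hk0
  rw [← Finset.esymm_map_val, ← Finset.esymm_map_val, hI]
  congr 1
  simp only [aux_eq (p : ℕ) ξ hξ k]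
  have := congrArg (Multiset.map (fun i : ℕ => ξ ^ i + ξ⁻¹ ^ i)) key
  rw [Multiset.map_map, Multiset.map_map] at this
  exact this.symm
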